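/- In the linear one-dimensional screening environment (types τ ∈ T ⊆ R with L¹ distribution and positive density, utilities α(τ) = α(0) + τβ over m allocations, with some allocation ℓ̄ satisfying α_{ℓ̄}(0) = β_{ℓ̄} = 0), the supremum of expected transfers over all IC-IR direct mechanisms equals the supremum over the subclass of IC-IR mechanisms whose allocation rule only takes values in the set of deterministic allocations together with a single fixed lottery b_0, where b_0 maximizes α(0)·q over lotteries q ∈ Δ({1,...,m}) with β·q = 0. -/

import Mathlib

open MeasureTheory Matrix
open scoped ENNReal

lemma aux_endpoint {m : ℕ} (l0 : Fin m) (α β : Fin m → ℝ) :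
    ∃ l : Fin m, (∀ k, β l ≤ β k) ∧
      ∀ q ∈ stdSimplex ℝ (Fin m), β ⬝ᵥ q = β l → α ⬝ᵥ q ≤ α l := by
  obtain ⟨l1, -, h1⟩ := Finset.exists_min_image Finset.univ β ⟨l0, Finset.mem_univ _⟩
  obtain ⟨l, hl, h2⟩ := Finset.exists_max_image (Finset.univ.filter (fun k => β k = β l1)) α
    ⟨l1, by simp⟩
  have hl' : β l = β l1 := by simpa using hl
  refine ⟨l, fun k => by rw [hl']; exact h1 k (Finset.mem_univ _), ?_⟩
  intro q hq hβ
  obtain ⟨hq0, hq1⟩ := hq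
  have hz : ∑ k, q k * (β k - β l) = 0 := by
    have : ∑ k, q k * (β k - β l) = β ⬝ᵥ q - (∑ k, q k) * β l := by
      rw [dotProduct, Finset.sum_mul, ← Finset.sum_sub_distrib]
      exact Finset.sum_congr rfl fun k _ => by ring
    rw [this, hq1, hβ]; ring
  have hz' := (Finset.sum_eq_zero_iff_of_nonneg (fun k _ =>
    mul_nonneg (hq0 k) (by rw [hl']; linarith [h1 k (Finset.mem_univ _)]))).1 hz
  have : α ⬝ᵥ q ≤ ∑ k, q k * α l := by
    rw [dotProduct]
    refine Finset.sum_le_sum fun k _ => ?_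
    rcases mul_eq_zero.1 (hz' k (Finset.mem_univ _)) with h | h
    · simp [h]
    · have := h2 k (by simp; linarith)
      nlinarith [hq0 k]
  rwa [← Finset.sum_mul, hq1, one_mul] at this

lemma aux_excess {m : ℕ} (α β q : Fin m → ℝ) (hq : q ∈ stdSimplex ℝ (Fin m)) (x y z : ℝ)
    (h : ∀ k, x * α k ≤ y + z * β k) : x * (α ⬝ᵥ q) ≤ y + z * (β ⬝ᵥ q) := by
  obtain ⟨hq0, hq1⟩ := hq
  have : ∑ k, x * α k * q k ≤ ∑ k, (y + z * β k) * q k :=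
    Finset.sum_le_sum fun k _ => mul_le_mul_of_nonneg_right (h k) (hq0 k)
  calc x * (α ⬝ᵥ q) = ∑ k, x * α k * q k := by
        rw [dotProduct, Finset.mul_sum]; exact Finset.sum_congr rfl fun k _ => by ring
    _ ≤ ∑ k, (y + z * β k) * q k := this
    _ = y * ∑ k, q k + z * (β ⬝ᵥ q) := by
        rw [dotProduct, Finset.mul_sum, Finset.mul_sum, ← Finset.sum_add_distrib]
        exact Finset.sum_congr rfl fun k _ => by ring
    _ = _ := by rw [hq1, mul_one]

lemma aux_lower {m : ℕ} (β q : Fin m → ℝ) (hq : q ∈ stdSimplex ℝ (Fin m)) (x : ℝ)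
    (h : ∀ k, x ≤ β k) : x ≤ β ⬝ᵥ q := by
  have := aux_excess β β q hq 0 (-x) 1 (fun k => by linarith [h k])
  linarith

lemma aux_nodes {m : ℕ} (α β : Fin m → ℝ) (l0 : Fin m)
    (b0 : Fin m → ℝ) (hb0 : b0 ∈ stdSimplex ℝ (Fin m)) (hb0β : β ⬝ᵥ b0 = 0)
    (hb0opt : ∀ q ∈ stdSimplex ℝ (Fin m), β ⬝ᵥ q = 0 → α ⬝ᵥ q ≤ α ⬝ᵥ b0) :
    ∃ (W : Finset ℝ) (N : ℝ → Fin m → ℝ), 0 ∈ W ∧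
      (∀ w ∈ W, N w ∈ stdSimplex ℝ (Fin m) ∧ β ⬝ᵥ N w = w ∧
        (N w = b0 ∨ ∃ l, N w = Pi.single l 1)) ∧
      (∀ w ∉ W, N w = 0) ∧
      (∀ q ∈ stdSimplex ℝ (Fin m), (∃ w ∈ W, w ≤ β ⬝ᵥ q) ∧ (∃ w ∈ W, β ⬝ᵥ q ≤ w)) ∧
      (∀ w ∈ W, ∀ q ∈ stdSimplex ℝ (Fin m), β ⬝ᵥ q = w → α ⬝ᵥ q ≤ α ⬝ᵥ N w) ∧
      (∀ a ∈ W, ∀ b ∈ W, a < b → (∀ w ∈ W, w ≤ a ∨ b ≤ w) →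
        ∀ q ∈ stdSimplex ℝ (Fin m),
          (b - a) * (α ⬝ᵥ q) ≤ (b - β ⬝ᵥ q) * (α ⬝ᵥ N a) + (β ⬝ᵥ q - a) * (α ⬝ᵥ N b)) := by
  classical
  let V : Option (Fin m) → Fin m → ℝ := fun v => v.elim b0 (fun l => Pi.single l 1)
  have hV : ∀ v, V v ∈ stdSimplex ℝ (Fin m) := by
    rintro (_ | l)
    · exact hb0
    · exact single_mem_stdSimplex ℝ l
  have hV' : ∀ v, V v = b0 ∨ ∃ l, V v = Pi.single l 1 := by
    rintro (_ | l)
    · exact Or.inl rfl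
    · exact Or.inr ⟨l, rfl⟩
  have hVs : ∀ (γ : Fin m → ℝ) l, γ ⬝ᵥ V (some l) = γ l := by
    intro γ l; simp [V]
  let Opt : Option (Fin m) → Prop := fun v =>
    ∀ q ∈ stdSimplex ℝ (Fin m), β ⬝ᵥ q = β ⬝ᵥ V v → α ⬝ᵥ q ≤ α ⬝ᵥ V v
  let W : Finset ℝ := (Finset.univ.filter Opt).image (fun v => β ⬝ᵥ V v)
  have hW : ∀ w, w ∈ W ↔ ∃ v, Opt v ∧ β ⬝ᵥ V v = w := by intro w; simp [W]
  let N : ℝ → Fin m → ℝ := fun w =>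
    if h : ∃ v, Opt v ∧ β ⬝ᵥ V v = w then V h.choose else 0
  have hN : ∀ w ∈ W, ∃ v, N w = V v ∧ Opt v ∧ β ⬝ᵥ V v = w := by
    intro w hw
    have h := (hW w).1 hw
    exact ⟨h.choose, by simp only [N, dif_pos h], h.choose_spec⟩
  have hopt : ∀ w ∈ W, ∀ q ∈ stdSimplex ℝ (Fin m), β ⬝ᵥ q = w → α ⬝ᵥ q ≤ α ⬝ᵥ N w := by
    intro w hw q hq h
    obtain ⟨v, h1, h2, h3⟩ := hN w hw
    rw [h1]; exact h2 q hq (h.trans h3.symm)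
  have hmem : ∀ w ∈ W, N w ∈ stdSimplex ℝ (Fin m) ∧ β ⬝ᵥ N w = w ∧
        (N w = b0 ∨ ∃ l, N w = Pi.single l 1) := by
    intro w hw
    obtain ⟨v, h1, h2, h3⟩ := hN w hw
    rw [h1]; exact ⟨hV v, h3, hV' v⟩
  refine ⟨W, N, ?_, hmem, ?_, ?_, hopt, ?_⟩
  · exact (hW 0).2 ⟨none, fun q hq h => hb0opt q hq (h.trans hb0β), hb0β⟩
  · intro w hw
    have : ¬ ∃ v, Opt v ∧ β ⬝ᵥ V v = w := fun h => hw ((hW w).2 h)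
    simp only [N, dif_neg this]
  · intro q hq
    constructor
    · obtain ⟨l, h1, h2⟩ := aux_endpoint l0 α β
      refine ⟨β l, (hW _).2 ⟨some l, ?_, hVs β l⟩, aux_lower β q hq _ h1⟩
      intro q hq h
      rw [hVs] at h ⊢
      exact h2 q hq h
    · obtain ⟨l, h1, h2⟩ := aux_endpoint l0 α (-β)
      refine ⟨β l, (hW _).2 ⟨some l, ?_, hVs β l⟩, ?_⟩
      · intro q hq h
        rw [hVs] at h ⊢
        exact h2 q hq (by rw [neg_dotProduct, h]; rfl)
      · have := aux_lower (-β) q hq _ h1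
        rw [neg_dotProduct] at this
        simp only [Pi.neg_apply] at this
        linarith
  · intro a ha b hb hab hadj q hq
    obtain ⟨ha1, ha2, -⟩ := hmem a ha
    obtain ⟨hb1, hb2, -⟩ := hmem b hb
    set A := α ⬝ᵥ N a with hA
    set B := α ⬝ᵥ N b with hB
    -- convex combination of two lotteries
    have hcomb : ∀ p ∈ stdSimplex ℝ (Fin m), ∀ p' ∈ stdSimplex ℝ (Fin m), ∀ w ∈ W,
        β ⬝ᵥ p < w → w < β ⬝ᵥ p' →
        (β ⬝ᵥ p' - w) * (α ⬝ᵥ p) + (w - β ⬝ᵥ p) * (α ⬝ᵥ p') ≤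
          (β ⬝ᵥ p' - β ⬝ᵥ p) * (α ⬝ᵥ N w) := by
      intro p hp p' hp' w hw h1 h2
      have hd : 0 < β ⬝ᵥ p' - β ⬝ᵥ p := by linarith
      have hc := convex_stdSimplex ℝ (Fin m) hp hp'
        (a := (β ⬝ᵥ p' - w) / (β ⬝ᵥ p' - β ⬝ᵥ p)) (b := (w - β ⬝ᵥ p) / (β ⬝ᵥ p' - β ⬝ᵥ p))
        (div_nonneg (by linarith) hd.le) (div_nonneg (by linarith) hd.le)
        (by field_simp; ring)
      have := hopt w hw _ hc (by
        rw [dotProduct_add, dotProduct_smul, dotProduct_smul, smul_eq_mul, smul_eq_mul]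
        field_simp; ring)
      rw [dotProduct_add, dotProduct_smul, dotProduct_smul, smul_eq_mul, smul_eq_mul] at this
      have h3 := mul_le_mul_of_nonneg_left this hd.le
      calc _ = _ := ?_
        _ ≤ _ := h3
      field_simp
    -- all items lie below the chord
    have key : ∀ k, (b - a) * α k ≤ (b - β k) * A + (β k - a) * B := by
      by_contra hcon
      push Not at hcon
      obtain ⟨k0, hk0⟩ := hcon
      obtain ⟨k, -, hk⟩ := Finset.exists_max_image Finset.univ
        (fun k => (b - a) * α k - ((b - β k) * A + (β k - a) * B)) ⟨k0, Finset.mem_univ _⟩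
      have hkpos : (b - β k) * A + (β k - a) * B < (b - a) * α k := by
        have := hk k0 (Finset.mem_univ _); linarith
      have hkW : β k ∈ W := by
        refine (hW _).2 ⟨some k, ?_, hVs β k⟩
        intro q hq h
        rw [hVs] at h ⊢
        have := aux_excess α β q hq (b - a) ((b - a) * α k - (B - A) * β k) (B - A) (fun j => by
          have := hk j (Finset.mem_univ _); linarith)
        rw [h] at this
        have h4 : (b - a) * (α ⬝ᵥ q) ≤ (b - a) * α k := by linarith
        exact le_of_mul_le_mul_left h4 (by linarith)
      have hkopt : α k ≤ α ⬝ᵥ N (β k) := by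
        have := hopt _ hkW _ (hV (some k)) (hVs β k)
        rwa [hVs] at this
      rcases hadj _ hkW with h | h
      · rcases h.lt_or_eq with h | h
        · have := hcomb _ (hV (some k)) _ hb1 a ha (by rwa [hVs]) (by rwa [hb2])
          rw [hVs, hVs, hb2] at this
          linarith
        · rw [h] at hkopt hkpos; nlinarith
      · rcases h.lt_or_eq with h | h
        · have := hcomb _ ha1 _ (hV (some k)) b hb (by rwa [ha2]) (by rwa [hVs])
          rw [hVs, hVs, ha2] at this
          linarith
        · rw [← h] at hkopt hkpos; nlinarith
    have := aux_excess α β q hq (b - a) (b * A - a * B) (B - A) (fun k => by linarith [key k])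
    linarith

lemma aux_ite_integral (x y θ : ℝ) (h0 : 0 ≤ θ) (h1 : θ ≤ 1) :
    ∫ u in Set.Ioc (0:ℝ) 1, (if u < θ then x else y) = y + (x - y) * θ := by
  have e : (fun u : ℝ => if u < θ then x else y) =
      fun u => y + (Set.Iio θ).indicator (fun _ => x - y) u := by
    funext u
    by_cases h : u < θ <;> simp [h]
  rw [e, integral_add (integrable_const _)
    ((integrable_const _).indicator measurableSet_Iio), integral_indicator measurableSet_Iio,
    Measure.restrict_restrict measurableSet_Iio]
  have : Set.Iio θ ∩ Set.Ioc (0:ℝ) 1 = Set.Ioo 0 θ := by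
    ext u; simp only [Set.mem_inter_iff, Set.mem_Iio, Set.mem_Ioc, Set.mem_Ioo]
    constructor
    · rintro ⟨a, b, c⟩; exact ⟨b, a⟩
    · rintro ⟨a, b⟩; exact ⟨b, a, by linarith⟩
  rw [this]
  simp [h0]; ring

lemma aux_round (W : Finset ℝ) (h0 : (0:ℝ) ∈ W) :
    ∃ σ : ℝ → ℝ → ℝ, Measurable (Function.uncurry σ) ∧
      (∀ u, Monotone (fun s => σ s u)) ∧ (∀ s u, σ s u ∈ W) ∧
      (∀ s u, s ≤ 0 → σ s u ≤ 0) ∧ (∀ s u, 0 ≤ s → 0 ≤ σ s u) ∧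
      (∀ s, (∃ w ∈ W, w ≤ s) → (∃ w ∈ W, s ≤ w) →
        ∃ lo ∈ W, ∃ hi ∈ W, lo ≤ s ∧ s ≤ hi ∧ (∀ w ∈ W, w ≤ lo ∨ hi ≤ w) ∧
          ∃ θ : ℝ, 0 ≤ θ ∧ θ ≤ 1 ∧ θ * (hi - lo) = s - lo ∧
          ∀ φ : ℝ → ℝ, ∫ u in Set.Ioc (0:ℝ) 1, φ (σ s u) = φ lo + (φ hi - φ lo) * θ) := by
  have hW : W.Nonempty := ⟨0, h0⟩
  let a := W.min' hW
  let b := W.max' hW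
  have ha : ∀ w ∈ W, a ≤ w := fun w hw => W.min'_le w hw
  have hb : ∀ w ∈ W, w ≤ b := fun w hw => W.le_max' w hw
  let lo : ℝ → ℝ := fun s => W.sup' hW (fun w => if w ≤ s then w else a)
  let hi : ℝ → ℝ := fun s => W.inf' hW (fun w => if s ≤ w then w else b)
  have hloW : ∀ s, lo s ∈ W := by
    intro s
    obtain ⟨w, hw, h⟩ := Finset.exists_mem_eq_sup' hW (fun w => if w ≤ s then w else a)
    change W.sup' hW _ ∈ W
    rw [h]
    split_ifs
    · exact hw
    · exact W.min'_mem hW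
  have hhiW : ∀ s, hi s ∈ W := by
    intro s
    obtain ⟨w, hw, h⟩ := Finset.exists_mem_eq_inf' hW (fun w => if s ≤ w then w else b)
    change W.inf' hW _ ∈ W
    rw [h]
    split_ifs
    · exact hw
    · exact W.max'_mem hW
  have lo_ge : ∀ s, ∀ w ∈ W, w ≤ s → w ≤ lo s := by
    intro s w hw h
    have := Finset.le_sup' (fun w => if w ≤ s then w else a) hw
    simpa [h] using this
  have hi_le : ∀ s, ∀ w ∈ W, s ≤ w → hi s ≤ w := by
    intro s w hw h
    have := Finset.inf'_le (fun w => if s ≤ w then w else b) hw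
    simpa [h] using this
  have lo_le : ∀ s, (∃ w ∈ W, w ≤ s) → lo s ≤ s := by
    rintro s ⟨w, hw, h⟩
    refine Finset.sup'_le _ _ fun v hv => ?_
    split_ifs with h'
    · exact h'
    · exact (ha w hw).trans h
  have le_hi : ∀ s, (∃ w ∈ W, s ≤ w) → s ≤ hi s := by
    rintro s ⟨w, hw, h⟩
    refine Finset.le_inf' _ _ fun v hv => ?_
    split_ifs with h'
    · exact h'
    · exact h.trans (hb w hw)
  have lo_le_hi : ∀ s, lo s ≤ hi s := by
    intro s
    refine Finset.sup'_le _ _ fun v hv => Finset.le_inf' _ _ fun w hw => ?_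
    split_ifs with h1 h2 h2
    · exact h1.trans h2
    · exact hb _ hv
    · exact ha _ hw
    · exact (ha _ hv).trans (hb _ hv)
  have dich : ∀ s s', s ≤ s' → hi s ≤ lo s' ∨ (lo s = lo s' ∧ hi s = hi s') := by
    intro s s' hs
    by_cases h : ∃ w ∈ W, s ≤ w ∧ w ≤ s'
    · obtain ⟨w, hw, h1, h2⟩ := h
      exact Or.inl ((hi_le s w hw h1).trans (lo_ge s' w hw h2))
    · push Not at h
      right
      constructor
      · refine Finset.sup'_congr hW rfl fun w hw => ?_
        have := h w hw
        by_cases h1 : w ≤ s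
        · simp [h1, h1.trans hs]
        · have : ¬ w ≤ s' := not_le.2 (this (le_of_not_ge h1))
          simp [h1, this]
      · refine Finset.inf'_congr hW rfl fun w hw => ?_
        have := h w hw
        by_cases h1 : s ≤ w
        · simp [h1, (this h1).le]
        · have : ¬ s' ≤ w := fun h2 => h1 (hs.trans h2)
          simp [h1, this]
  have lo_mono : Monotone lo := by
    intro s s' hs
    rcases dich s s' hs with h | h
    · exact (lo_le_hi s).trans h
    · exact h.1.le
  have hi_mono : Monotone hi := by
    intro s s' hs
    rcases dich s s' hs with h | h
    · exact h.trans (lo_le_hi s')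
    · exact h.2.le
  let θ : ℝ → ℝ := fun s => (s - lo s) / (hi s - lo s)
  let σ : ℝ → ℝ → ℝ := fun s u => if u < θ s then hi s else lo s
  have hlo_σ : ∀ s u, lo s ≤ σ s u := by
    intro s u; simp only [σ]; split_ifs
    · exact lo_le_hi s
    · exact le_rfl
  have hσ_hi : ∀ s u, σ s u ≤ hi s := by
    intro s u; simp only [σ]; split_ifs
    · exact le_rfl
    · exact lo_le_hi s
  have hθm : Measurable θ :=
    (measurable_id.sub lo_mono.measurable).div (hi_mono.measurable.sub lo_mono.measurable)
  refine ⟨σ, ?_, ?_, ?_, ?_, ?_, ?_⟩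
  · exact Measurable.ite (measurableSet_lt measurable_snd (hθm.comp measurable_fst))
      (hi_mono.measurable.comp measurable_fst) (lo_mono.measurable.comp measurable_fst)
  · intro u s s' hs
    rcases dich s s' hs with h | ⟨h1, h2⟩
    · exact (hσ_hi s u).trans (h.trans (hlo_σ s' u))
    · have : θ s ≤ θ s' := by
        simp only [θ, h1, h2]
        exact div_le_div_of_nonneg_right (by linarith) (by linarith [lo_le_hi s'])
      by_cases h : u < θ s
      · have h' := h.trans_le this
        simp [σ, h, h', h2]
      · calc σ s u = lo s := by simp [σ, h]
          _ = lo s' := h1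
          _ ≤ σ s' u := hlo_σ s' u
  · intro s u; simp only [σ]; split_ifs
    · exact hhiW s
    · exact hloW s
  · intro s u h; exact (hσ_hi s u).trans (hi_le s 0 h0 h)
  · intro s u h; exact (lo_ge s 0 h0 h).trans (hlo_σ s u)
  · intro s h1 h2
    have e1 := lo_le s h1
    have e2 := le_hi s h2
    have t0 : 0 ≤ θ s := div_nonneg (by linarith) (by linarith)
    have t1 : θ s ≤ 1 := div_le_one_of_le₀ (by linarith) (by linarith)
    refine ⟨lo s, hloW s, hi s, hhiW s, e1, e2, ?_, θ s, t0, t1, ?_, ?_⟩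
    · intro w hw
      rcases le_total w s with h | h
      · exact Or.inl (lo_ge s w hw h)
      · exact Or.inr (hi_le s w hw h)
    · rcases (lo_le_hi s).lt_or_eq with h | h
      · exact div_mul_cancel₀ _ (by linarith)
      · rw [h, sub_self, mul_zero]; linarith
    · intro φ
      rw [← aux_ite_integral _ _ _ t0 t1]
      congr 1
      funext u
      exact apply_ite φ _ _ _

/-- Envelope formula. -/
lemma aux_env (T : Set ℝ) (hT : T.OrdConnected) (s U : ℝ → ℝ)
    (C : NNReal) (hU : LipschitzWith C U)
    (hsub : ∀ x ∈ T, ∀ y ∈ T, U x + s x * (y - x) ≤ U y) (a b : ℝ) (ha : a ∈ T) (hb : b ∈ T) :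
    ∫ x in a..b, s x = U b - U a := by
  wlog hab : a ≤ b generalizing a b
  · rw [intervalIntegral.integral_symm, this b a hb ha (le_of_not_ge hab)]; ring
  have h1 := (hU.lipschitzOnWith (s := Set.uIcc a b)).absolutelyContinuousOnInterval.integral_deriv_eq_sub
  rw [← h1, intervalIntegral.integral_of_le hab, intervalIntegral.integral_of_le hab,
    integral_Ioc_eq_integral_Ioo, integral_Ioc_eq_integral_Ioo]
  refine setIntegral_congr_ae measurableSet_Ioo ?_
  filter_upwards [hU.ae_differentiableAt_real] with x hx hxm
  have hxT : ∀ y ∈ Set.Ioo a b, y ∈ T := fun y hy => hT.out ha hb ⟨hy.1.le, hy.2.le⟩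
  have hd : HasDerivAt (fun y => U y - s x * y) (deriv U x - s x * 1) x :=
    hx.hasDerivAt.sub ((hasDerivAt_id x).const_mul (s x))
  have hmin : IsLocalMin (fun y => U y - s x * y) x := by
    filter_upwards [Ioo_mem_nhds hxm.1 hxm.2] with y hy
    have := hsub x (hxT x hxm) y (hxT y hy)
    linarith
  have := hmin.hasDerivAt_eq_zero hd
  linarith

lemma aux_bound {m : ℕ} (α : Fin m → ℝ) : ∃ B : ℝ, 0 ≤ B ∧ ∀ q ∈ stdSimplex ℝ (Fin m), |α ⬝ᵥ q| ≤ B := by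
  refine ⟨∑ k, |α k|, Finset.sum_nonneg fun k _ => abs_nonneg _, fun q hq => ?_⟩
  have hle : ∀ k, |α k| ≤ ∑ k, |α k| := fun k =>
    Finset.single_le_sum (f := fun k => |α k|) (fun k _ => abs_nonneg _) (Finset.mem_univ k)
  rw [abs_le]
  constructor
  · exact aux_lower α q hq _ fun k => by linarith [hle k, neg_abs_le (α k)]
  · have := aux_lower (-α) q hq (-∑ k, |α k|) fun k => by
      simp only [Pi.neg_apply]; linarith [hle k, le_abs_self (α k)]
    rw [neg_dotProduct] at this; linarith

lemma aux_facts {m : ℕ} (α0 β : Fin m → ℝ) (T : Set ℝ) (q : ℝ → Fin m → ℝ) (t : ℝ → ℝ)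
    (hq : ∀ τ ∈ T, q τ ∈ stdSimplex ℝ (Fin m))
    (hIC : ∀ τ ∈ T, ∀ τ' ∈ T,
          (α0 + τ • β) ⬝ᵥ q τ' - t τ' ≤ (α0 + τ • β) ⬝ᵥ q τ - t τ)
    (hIR : ∀ τ ∈ T, 0 ≤ (α0 + τ • β) ⬝ᵥ q τ - t τ) :
    ∃ (s U : ℝ → ℝ) (C : NNReal), Monotone s ∧ LipschitzWith C U ∧
      (∀ τ ∈ T, s τ = β ⬝ᵥ q τ) ∧
      (∀ τ ∈ T, U τ = (α0 + τ • β) ⬝ᵥ q τ - t τ) ∧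
      (∀ τ ∈ T, t τ = α0 ⬝ᵥ q τ + τ * s τ - U τ) ∧
      (∀ x ∈ T, ∀ y ∈ T, U x + s x * (y - x) ≤ U y) ∧ (∀ τ ∈ T, 0 ≤ U τ) := by
  have ex : ∀ (τ : ℝ) (p : Fin m → ℝ), (α0 + τ • β) ⬝ᵥ p = α0 ⬝ᵥ p + τ * (β ⬝ᵥ p) := by
    intro τ p; rw [add_dotProduct, smul_dotProduct, smul_eq_mul]
  obtain ⟨B, hB0, hB⟩ := aux_bound β
  let U0 : ℝ → ℝ := fun τ => (α0 + τ • β) ⬝ᵥ q τ - t τ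
  have hsub0 : ∀ x ∈ T, ∀ y ∈ T, U0 x + (β ⬝ᵥ q x) * (y - x) ≤ U0 y := by
    intro x hx y hy
    have := hIC y hy x hx
    simp only [U0]
    rw [ex] at this ⊢
    linarith
  have hmono : MonotoneOn (fun τ => β ⬝ᵥ q τ) T := by
    intro x hx y hy hxy
    rcases hxy.lt_or_eq with h | h
    · have h1 := hsub0 x hx y hy
      have h2 := hsub0 y hy x hx
      have h3 : (y - x) * (β ⬝ᵥ q x) ≤ (y - x) * (β ⬝ᵥ q y) := by linarith
      exact le_of_mul_le_mul_left h3 (by linarith)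
    · rw [h]
  have hb : ∀ τ ∈ T, |β ⬝ᵥ q τ| ≤ B := fun τ hτ => hB _ (hq τ hτ)
  obtain ⟨s, hs, hsT⟩ := hmono.exists_monotone_extension
    ⟨-B, by rintro _ ⟨τ, hτ, rfl⟩; exact (abs_le.1 (hb τ hτ)).1⟩
    ⟨B, by rintro _ ⟨τ, hτ, rfl⟩; exact (abs_le.1 (hb τ hτ)).2⟩
  have hlip : LipschitzOnWith ⟨B, hB0⟩ U0 T := by
    refine LipschitzOnWith.of_dist_le_mul fun x hx y hy => ?_
    rw [Real.dist_eq, Real.dist_eq]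
    change _ ≤ B * _
    have h1 := hsub0 x hx y hy
    have h2 := hsub0 y hy x hx
    have h3 : ∀ z ∈ T, |(β ⬝ᵥ q z) * (x - y)| ≤ B * |x - y| := fun z hz => by
      rw [abs_mul]; exact mul_le_mul_of_nonneg_right (hb z hz) (abs_nonneg _)
    have h4 := abs_le.1 (h3 x hx)
    have h5 := abs_le.1 (h3 y hy)
    rw [abs_le]
    constructor <;> linarith
  obtain ⟨U, hU, hUT⟩ := hlip.extend_real
  refine ⟨s, U, _, hs, hU, fun τ hτ => (hsT hτ).symm, fun τ hτ => (hUT hτ).symm, ?_, ?_, ?_⟩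
  · intro τ hτ
    rw [← hUT hτ, ← hsT hτ]
    simp only [U0, ex]; ring
  · intro x hx y hy
    rw [← hUT hx, ← hUT hy, ← hsT hx]
    exact hsub0 x hx y hy
  · intro τ hτ
    rw [← hUT hτ]; exact hIR τ hτ

lemma aux_integrable {m : ℕ} (α0 β : Fin m → ℝ) (T : Set ℝ) (q : ℝ → Fin m → ℝ) (t : ℝ → ℝ)
    (μ : Measure ℝ) [IsProbabilityMeasure μ] (hμ : ∀ᵐ τ ∂μ, τ ∈ T)
    (hL1 : Integrable (fun τ : ℝ => τ) μ) (ht : Measurable t)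
    (hq : ∀ τ ∈ T, q τ ∈ stdSimplex ℝ (Fin m))
    (s U : ℝ → ℝ) (C : NNReal) (hU : LipschitzWith C U)
    (hs : ∀ τ ∈ T, s τ = β ⬝ᵥ q τ)
    (htT : ∀ τ ∈ T, t τ = α0 ⬝ᵥ q τ + τ * s τ - U τ) : Integrable t μ := by
  obtain ⟨B, hB0, hB⟩ := aux_bound β
  obtain ⟨A, hA0, hA⟩ := aux_bound α0
  refine Integrable.mono' (g := fun τ => A + B * |τ| + (|U 0| + C * |τ|)) ?_
    ht.aestronglyMeasurable ?_
  · exact ((integrable_const _).add (hL1.abs.const_mul _)).add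
      ((integrable_const _).add (hL1.abs.const_mul _))
  · filter_upwards [hμ] with τ hτ
    rw [htT τ hτ, Real.norm_eq_abs]
    have h1 := abs_le.1 (hA _ (hq τ hτ))
    have h2 : |τ * s τ| ≤ B * |τ| := by
      rw [abs_mul, mul_comm, hs τ hτ]
      exact mul_le_mul_of_nonneg_right (hB _ (hq τ hτ)) (abs_nonneg _)
    have h3 := hU.dist_le_mul τ 0
    rw [Real.dist_eq, Real.dist_eq, sub_zero] at h3
    have h2 := abs_le.1 h2
    have h3 := abs_le.1 h3
    have h4 := neg_abs_le (U 0)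
    have h5 := le_abs_self (U 0)
    rw [abs_le]
    constructor <;> linarith

lemma aux_core {m : ℕ} (α0 β : Fin m → ℝ) (l0 : Fin m)
    (T : Set ℝ) (hT : T.OrdConnected)
    (μ : Measure ℝ) [IsProbabilityMeasure μ] (hμ : ∀ᵐ τ ∂μ, τ ∈ T)
    (hL1 : Integrable (fun τ : ℝ => τ) μ)
    (b0 : Fin m → ℝ) (hb0 : b0 ∈ stdSimplex ℝ (Fin m)) (hb0β : β ⬝ᵥ b0 = 0)
    (hb0opt : ∀ q ∈ stdSimplex ℝ (Fin m), β ⬝ᵥ q = 0 → α0 ⬝ᵥ q ≤ α0 ⬝ᵥ b0)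
    (q : ℝ → Fin m → ℝ) (t : ℝ → ℝ) (ht : Measurable t)
    (hq : ∀ τ ∈ T, q τ ∈ stdSimplex ℝ (Fin m))
    (hIC : ∀ τ ∈ T, ∀ τ' ∈ T,
          (α0 + τ • β) ⬝ᵥ q τ' - t τ' ≤ (α0 + τ • β) ⬝ᵥ q τ - t τ)
    (hIR : ∀ τ ∈ T, 0 ≤ (α0 + τ • β) ⬝ᵥ q τ - t τ)
    (c : ℝ) (hc : c ∈ T) (hc0 : (α0 + c • β) ⬝ᵥ q c - t c = 0) :
    ∃ (q' : ℝ → Fin m → ℝ) (t' : ℝ → ℝ), Measurable t' ∧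
      (∀ τ ∈ T, q' τ ∈ stdSimplex ℝ (Fin m)) ∧
      (∀ τ ∈ T, q' τ = b0 ∨ ∃ l : Fin m, q' τ = Pi.single l 1) ∧
      (∀ τ ∈ T, ∀ τ' ∈ T,
          (α0 + τ • β) ⬝ᵥ q' τ' - t' τ' ≤ (α0 + τ • β) ⬝ᵥ q' τ - t' τ) ∧
      (∀ τ ∈ T, 0 ≤ (α0 + τ • β) ⬝ᵥ q' τ - t' τ) ∧
      ∫ τ, t τ ∂μ ≤ ∫ τ, t' τ ∂μ := by
  obtain ⟨s, U, C, hs, hU, hsT, hUT, htT, hsub, hU0⟩ := aux_facts α0 β T q t hq hIC hIR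
  have htint := aux_integrable α0 β T q t μ hμ hL1 ht hq s U C hU hsT htT
  have hUc : U c = 0 := (hUT c hc).trans hc0
  obtain ⟨W, N, h0W, hN, hN0, hrange, hopt, hinterp⟩ := aux_nodes α0 β l0 b0 hb0 hb0β hb0opt
  obtain ⟨σ, hσm, hσmono, hσW, hσneg, hσpos, hσavg⟩ := aux_round W h0W
  have ex : ∀ (τ : ℝ) (p : Fin m → ℝ), (α0 + τ • β) ⬝ᵥ p = α0 ⬝ᵥ p + τ * (β ⬝ᵥ p) := by
    intro τ p; rw [add_dotProduct, smul_dotProduct, smul_eq_mul]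
  let A : ℝ → ℝ := fun w => α0 ⬝ᵥ N w
  have hAm : Measurable A := by
    have : A = fun w => ∑ v ∈ W, if w = v then A v else 0 := by
      funext w
      by_cases h : w ∈ W
      · simp [h]
      · simp [h, A, hN0 w h]
    rw [this]
    exact Finset.measurable_sum _ fun v _ =>
      Measurable.ite (measurableSet_singleton v) measurable_const measurable_const
  obtain ⟨Ba, hBa0, hBa⟩ := aux_bound α0
  obtain ⟨Bb, hBb0, hBb⟩ := aux_bound β
  have hAb : ∀ w ∈ W, |A w| ≤ Ba := fun w hw => hBa _ (hN w hw).1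
  have hWb : ∀ w ∈ W, |w| ≤ Bb := fun w hw => by
    have := hBb _ (hN w hw).1
    rwa [(hN w hw).2.1] at this
  let S : ℝ → ℝ → ℝ := fun x u => σ (s x) u
  have hSm : Measurable (Function.uncurry S) :=
    hσm.comp ((hs.measurable.comp measurable_fst).prodMk measurable_snd)
  have hSmono : ∀ u, Monotone (fun x => S x u) := fun u x y h => hσmono u (hs h)
  have hSint : ∀ u a b, IntervalIntegrable (fun x => S x u) volume a b := fun u a b =>
    (hSmono u).intervalIntegrable
  let I : ℝ → ℝ → ℝ := fun τ u => ∫ x in c..τ, S x u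
  have hIm : Measurable (Function.uncurry I) := by
    refine measurable_uncurry_of_continuous_of_measurable ?_ ?_
    · intro u
      exact intervalIntegral.continuous_primitive (hSint u) c
    · intro τ
      have h : ∀ ν : Measure ℝ, SFinite ν → Measurable (fun u => ∫ x, S x u ∂ν) := fun ν _ =>
        (StronglyMeasurable.integral_prod_left' (μ := ν) hSm.stronglyMeasurable).measurable
      exact (h _ inferInstance).sub (h _ inferInstance)
  have hIb : ∀ τ u, |I τ u| ≤ Bb * |τ - c| := by
    intro τ u
    exact intervalIntegral.norm_integral_le_of_norm_le_const (f := fun x => S x u) (C := Bb)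
      fun x _ => hWb (S x u) (hσW _ _)
  -- subgradient inequality for the rounded rule
  have hIsub : ∀ u x y, I x u + S x u * (y - x) ≤ I y u := by
    intro u x y
    have e : I y u - I x u = ∫ z in x..y, S z u :=
      intervalIntegral.integral_interval_sub_left (hSint u _ _) (hSint u _ _)
    rcases le_total x y with h | h
    · have := intervalIntegral.integral_mono_on h (intervalIntegrable_const (c := S x u))
        (hSint u x y) (fun z hz => hSmono u hz.1)
      rw [intervalIntegral.integral_const, smul_eq_mul] at this
      linarith
    · have := intervalIntegral.integral_mono_on h (hSint u y x)
        (intervalIntegrable_const (c := S x u)) (fun z hz => hSmono u hz.2)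
      rw [intervalIntegral.integral_const, smul_eq_mul] at this
      rw [intervalIntegral.integral_symm] at e
      linarith
  have hsl : ∀ x ∈ T, x < c → s x ≤ 0 := by
    intro x hx h
    have h1 := hsub x hx c hc
    have h2 := hU0 x hx
    by_contra hcon
    have := mul_pos (not_le.1 hcon) (sub_pos.2 h)
    linarith
  have hsr : ∀ x ∈ T, c < x → 0 ≤ s x := by
    intro x hx h
    have h1 := hsub x hx c hc
    have h2 := hU0 x hx
    by_contra hcon
    have := mul_pos_of_neg_of_neg (not_le.1 hcon) (sub_neg.2 h)
    linarith
  have hI0 : ∀ τ ∈ T, ∀ u, 0 ≤ I τ u := by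
    intro τ hτ u
    rcases le_total c τ with h | h
    · simp only [I]
      rw [intervalIntegral.integral_of_le h]
      exact setIntegral_nonneg measurableSet_Ioc fun x hx =>
        hσpos _ _ (hsr x (hT.out hc hτ ⟨hx.1.le, hx.2⟩) hx.1)
    · simp only [I]
      rw [intervalIntegral.integral_of_ge h, integral_Ioc_eq_integral_Ioo, neg_nonneg]
      exact setIntegral_nonpos measurableSet_Ioo fun x hx =>
        hσneg _ _ (hsl x (hT.out hτ hc ⟨hx.1.le, hx.2.le⟩) hx.2)
  -- the random mechanism
  let F : ℝ → ℝ → ℝ := fun τ u => A (S τ u) + τ * S τ u - I τ u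
  have hFm : Measurable (Function.uncurry F) :=
    ((hAm.comp hSm).add (measurable_fst.mul hSm)).sub hIm
  let ν : Measure ℝ := volume.restrict (Set.Ioc (0:ℝ) 1)
  have : IsProbabilityMeasure ν := ⟨by simp [ν]⟩
  have hFint : Integrable (Function.uncurry F) (μ.prod ν) := by
    refine Integrable.mono' (g := fun z => Ba + Bb * |z.1| + Bb * (|z.1| + |c|)) ?_
      hFm.aestronglyMeasurable (Filter.Eventually.of_forall ?_)
    · have h1 : Integrable (fun z : ℝ × ℝ => |z.1|) (μ.prod ν) := hL1.abs.comp_fst ν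
      exact ((integrable_const _).add (h1.const_mul _)).add
        ((h1.add (integrable_const _)).const_mul _)
    · rintro ⟨τ, u⟩
      simp only [Function.uncurry_apply_pair, F]
      rw [Real.norm_eq_abs]
      have h1 := abs_le.1 (hAb _ (hσW (s τ) u))
      have h2 : |τ * S τ u| ≤ Bb * |τ| := by
        rw [abs_mul, mul_comm]
        exact mul_le_mul_of_nonneg_right (hWb _ (hσW _ _)) (abs_nonneg _)
      have h2 := abs_le.1 h2
      have h3 : |I τ u| ≤ Bb * (|τ| + |c|) := (hIb τ u).trans
        (mul_le_mul_of_nonneg_left (abs_sub _ _) hBb0)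
      have h3 := abs_le.1 h3
      change -Ba ≤ A (S τ u) ∧ A (S τ u) ≤ Ba at h1
      rw [abs_le]
      constructor <;> linarith
  -- averages
  have hSavg : ∀ x ∈ T, ∫ u, S x u ∂ν = s x := by
    intro x hx
    have hr := hrange _ (hq x hx)
    rw [← hsT x hx] at hr
    obtain ⟨lo, hlo, hi, hhi, h1, h2, h3, θ, t0, t1, hθ, hφ⟩ := hσavg (s x) hr.1 hr.2
    have := hφ (fun w => w)
    simp only [S, ν]
    rw [this]; linarith
  have hAavg : ∀ x ∈ T, α0 ⬝ᵥ q x ≤ ∫ u, A (S x u) ∂ν := by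
    intro x hx
    have hr := hrange _ (hq x hx)
    rw [← hsT x hx] at hr
    obtain ⟨lo, hlo, hi, hhi, h1, h2, h3, θ, t0, t1, hθ, hφ⟩ := hσavg (s x) hr.1 hr.2
    simp only [S, ν]
    rw [hφ A]
    rcases (h1.trans h2).lt_or_eq with h | h
    · have := hinterp lo hlo hi hhi h h3 _ (hq x hx)
      rw [← hsT x hx] at this
      change _ ≤ (hi - s x) * A lo + (s x - lo) * A hi at this
      have h4 : (hi - lo) * (α0 ⬝ᵥ q x) ≤ (hi - lo) * (A lo + (A hi - A lo) * θ) := by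
        have e1 : s x = lo + θ * (hi - lo) := by linarith
        rw [e1] at this
        linarith
      exact le_of_mul_le_mul_left h4 (by linarith)
    · have : lo = s x := le_antisymm h1 (by rw [h]; exact h2)
      have h5 := hopt lo hlo _ (hq x hx) (by rw [this, hsT x hx])
      rw [← h]
      simpa using h5
  have hSint' : ∀ x, Integrable (fun u => S x u) ν := fun x =>
    Integrable.mono' (integrable_const Bb) (hSm.comp measurable_prodMk_left).aestronglyMeasurable
      (Filter.Eventually.of_forall fun u => hWb _ (hσW _ _))
  have hAint' : ∀ x, Integrable (fun u => A (S x u)) ν := fun x =>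
    Integrable.mono' (integrable_const Ba)
      (hAm.comp (hSm.comp measurable_prodMk_left)).aestronglyMeasurable
      (Filter.Eventually.of_forall fun u => hAb _ (hσW _ _))
  have hIint' : ∀ x, Integrable (fun u => I x u) ν := fun x =>
    Integrable.mono' (integrable_const (Bb * |x - c|))
      (hIm.comp measurable_prodMk_left).aestronglyMeasurable
      (Filter.Eventually.of_forall fun u => hIb x u)
  have hIavg : ∀ τ ∈ T, ∫ u, I τ u ∂ν = U τ := by
    intro τ hτ
    have hfin : IsFiniteMeasure (volume.restrict (Set.uIoc c τ)) := ⟨by simp [Set.uIoc]⟩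
    have hsw : ∫ x in c..τ, ∫ u, S x u ∂ν = ∫ u, (∫ x in c..τ, S x u) ∂ν := by
      refine intervalIntegral_integral_swap ?_
      refine Integrable.mono' (integrable_const Bb) hSm.aestronglyMeasurable
        (Filter.Eventually.of_forall fun z => hWb _ (hσW _ _))
    simp only [I]
    rw [← hsw]
    have e : ∫ x in c..τ, ∫ u, S x u ∂ν = ∫ x in c..τ, s x :=
      intervalIntegral.integral_congr fun x hx => hSavg x (hT.uIcc_subset hc hτ hx)
    rw [e, aux_env T hT s U C hU hsub c τ hc hτ, hUc, sub_zero]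
  have hFavg : ∀ τ ∈ T, t τ ≤ ∫ u, F τ u ∂ν := by
    intro τ hτ
    have hAS : Integrable (fun u => A (S τ u) + τ * S τ u) ν :=
      (hAint' τ).add ((hSint' τ).const_mul τ)
    simp only [F]
    rw [integral_sub hAS (hIint' τ),
      integral_add (hAint' τ) ((hSint' τ).const_mul τ), integral_const_mul, hSavg τ hτ,
      hIavg τ hτ, htT τ hτ]
    linarith [hAavg τ hτ]
  have htot : ∫ τ, t τ ∂μ ≤ ∫ u, ∫ τ, F τ u ∂μ ∂ν := by
    rw [← integral_integral_swap hFint]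
    refine integral_mono_ae htint hFint.integral_prod_left ?_
    filter_upwards [hμ] with τ hτ using hFavg τ hτ
  obtain ⟨u, hu⟩ := exists_integral_le (μ := ν) hFint.integral_prod_right
  simp only [Function.uncurry_apply_pair] at hu
  have hβN : ∀ τ, β ⬝ᵥ N (S τ u) = S τ u := fun τ => (hN _ (hσW _ _)).2.1
  refine ⟨fun τ => N (S τ u), fun τ => F τ u, hFm.comp measurable_prodMk_right,
    fun τ _ => (hN _ (hσW _ _)).1, fun τ _ => (hN _ (hσW _ _)).2.2, ?_, ?_, htot.trans hu⟩
  · intro τ hτ τ' hτ'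
    rw [ex, ex, hβN, hβN]
    have := hIsub u τ' τ
    simp only [F, A]
    linarith
  · intro τ hτ
    rw [ex, hβN]
    have := hI0 τ hτ u
    simp only [F, A]
    linarith

lemma aux_step {m : ℕ} (α0 β : Fin m → ℝ)
    (T : Set ℝ) (h0T : T.Nonempty)
    (μ : Measure ℝ) [IsProbabilityMeasure μ] (hμ : ∀ᵐ τ ∂μ, τ ∈ T)
    (hL1 : Integrable (fun τ : ℝ => τ) μ)
    (b0 : Fin m → ℝ) (hb0 : b0 ∈ stdSimplex ℝ (Fin m)) (hb0β : β ⬝ᵥ b0 = 0)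
    (q : ℝ → Fin m → ℝ) (t : ℝ → ℝ) (ht : Measurable t)
    (hq : ∀ τ ∈ T, q τ ∈ stdSimplex ℝ (Fin m))
    (hIC : ∀ τ ∈ T, ∀ τ' ∈ T,
          (α0 + τ • β) ⬝ᵥ q τ' - t τ' ≤ (α0 + τ • β) ⬝ᵥ q τ - t τ)
    (hIR : ∀ τ ∈ T, 0 ≤ (α0 + τ • β) ⬝ᵥ q τ - t τ) (ε : ℝ) (hε : 0 < ε) :
    ∃ (q' : ℝ → Fin m → ℝ) (t' : ℝ → ℝ), Measurable t' ∧
      (∀ τ ∈ T, q' τ ∈ stdSimplex ℝ (Fin m)) ∧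
      (∀ τ ∈ T, ∀ τ' ∈ T,
          (α0 + τ • β) ⬝ᵥ q' τ' - t' τ' ≤ (α0 + τ • β) ⬝ᵥ q' τ - t' τ) ∧
      (∀ τ ∈ T, 0 ≤ (α0 + τ • β) ⬝ᵥ q' τ - t' τ) ∧
      (∃ c ∈ T, (α0 + c • β) ⬝ᵥ q' c - t' c = 0) ∧
      ∫ τ, t τ ∂μ - ε ≤ ∫ τ, t' τ ∂μ := by
  classical
  obtain ⟨s, U, C, hs, hU, hsT, hUT, htT, hsub, hU0⟩ := aux_facts α0 β T q t hq hIC hIR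
  have htint := aux_integrable α0 β T q t μ hμ hL1 ht hq s U C hU hsT htT
  have ex : ∀ (τ : ℝ) (p : Fin m → ℝ), (α0 + τ • β) ⬝ᵥ p = α0 ⬝ᵥ p + τ * (β ⬝ᵥ p) := by
    intro τ p; rw [add_dotProduct, smul_dotProduct, smul_eq_mul]
  set A0 := α0 ⬝ᵥ b0 with hA0
  have hKm : ∀ c, MeasurableSet {x | U x < U c} := fun c =>
    measurableSet_lt hU.continuous.measurable measurable_const
  have hgint : Integrable (fun x => |t x - A0|) μ := (htint.sub (integrable_const A0)).abs
  -- choose the cutoff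
  obtain ⟨c, hc, hloss⟩ : ∃ c ∈ T,
      ∫ x, {x | U x < U c}.indicator (fun x => |t x - A0|) x ∂μ ≤ ε := by
    by_cases hmin : ∃ c ∈ T, ∀ x ∈ T, U c ≤ U x
    · obtain ⟨c, hc, h⟩ := hmin
      refine ⟨c, hc, ?_⟩
      rw [integral_eq_zero_of_ae]
      · exact hε.le
      · filter_upwards [hμ] with x hx
        simp [not_lt.2 (h x hx)]
    · push Not at hmin
      have hbdd : BddBelow (U '' T) := ⟨0, by rintro _ ⟨x, hx, rfl⟩; exact hU0 x hx⟩
      obtain ⟨v, -, hv, hvm⟩ := exists_seq_tendsto_sInf (h0T.image U) hbdd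
      choose c hc hcv using hvm
      have hlim : Filter.Tendsto
          (fun n => ∫ x, {x | U x < U (c n)}.indicator (fun x => |t x - A0|) x ∂μ)
          Filter.atTop (nhds (∫ x, (0:ℝ) ∂μ)) := by
        refine tendsto_integral_of_dominated_convergence (fun x => |t x - A0|) ?_ hgint ?_ ?_
        · intro n
          exact (hgint.indicator (hKm _)).aestronglyMeasurable
        · intro n
          refine Filter.Eventually.of_forall fun x => ?_
          refine (norm_indicator_le_norm_self _ _).trans ?_
          simp
        · filter_upwards [hμ] with x hx
          obtain ⟨y, hy, hyx⟩ := hmin x hx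
          have h1 : sInf (U '' T) < U x := (csInf_le hbdd ⟨y, hy, rfl⟩).trans_lt hyx
          refine tendsto_const_nhds.congr' ?_
          filter_upwards [hv.eventually_lt_const h1] with n hn
          rw [← hcv] at hn
          simp [not_lt.2 hn.le]
      rw [integral_zero] at hlim
      obtain ⟨n, hn⟩ := (hlim.eventually_lt_const hε).exists
      exact ⟨c n, hc n, hn.le⟩
  have hUb : ∀ τ : ℝ, (α0 + τ • β) ⬝ᵥ b0 = A0 := by intro τ; rw [ex, hb0β]; ring
  let q' : ℝ → Fin m → ℝ := fun τ => if U τ < U c then b0 else q τ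
  let t' : ℝ → ℝ := fun τ => if U τ < U c then A0 else t τ + U c
  have ht'm : Measurable t' := Measurable.ite (hKm c) measurable_const (ht.add_const _)
  have hU' : ∀ τ ∈ T, (α0 + τ • β) ⬝ᵥ q' τ - t' τ = if U τ < U c then 0 else U τ - U c := by
    intro τ hτ
    simp only [q', t']
    split_ifs
    · rw [hUb]; ring
    · rw [hUT τ hτ]; ring
  have hU'0 : ∀ τ ∈ T, 0 ≤ (α0 + τ • β) ⬝ᵥ q' τ - t' τ := by
    intro τ hτ
    rw [hU' τ hτ]
    split_ifs with h
    · exact le_rfl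
    · linarith
  refine ⟨q', t', ht'm, ?_, ?_, hU'0, ⟨c, hc, by rw [hU' c hc]; simp⟩, ?_⟩
  · intro τ hτ
    simp only [q']
    split_ifs
    · exact hb0
    · exact hq τ hτ
  · intro τ hτ τ' hτ'
    by_cases h' : U τ' < U c
    · have : (α0 + τ • β) ⬝ᵥ q' τ' - t' τ' = 0 := by
        simp only [q', t', if_pos h', hUb, sub_self]
      rw [this]; exact hU'0 τ hτ
    · have e : (α0 + τ • β) ⬝ᵥ q' τ' - t' τ' = (α0 + τ • β) ⬝ᵥ q τ' - t τ' - U c := by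
        simp only [q', t', if_neg h']; ring
      have h1 := hIC τ hτ τ' hτ'
      rw [← hUT τ hτ] at h1
      rw [e, hU' τ hτ]
      split_ifs with h
      · linarith
      · linarith
  · have ht'int : Integrable t' μ := by
      have : t' = fun τ => {x | U x < U c}.indicator (fun _ => A0) τ +
          {x | U x < U c}ᶜ.indicator (fun x => t x + U c) τ := by
        funext τ
        by_cases h : U τ < U c
        · simp [t', h]
        · simp [t', h]
      rw [this]
      exact ((integrable_const A0).indicator (hKm c)).add
        ((htint.add (integrable_const (U c))).indicator (hKm c).compl)
    have h1 : ∫ τ, t τ ∂μ ≤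
        ∫ τ, (t' τ + {x | U x < U c}.indicator (fun x => |t x - A0|) τ) ∂μ := by
      refine integral_mono htint (ht'int.add (hgint.indicator (hKm c))) fun τ => ?_
      by_cases h : U τ < U c
      · simp only [t', if_pos h, Set.indicator, Set.mem_setOf_eq]
        linarith [le_abs_self (t τ - A0)]
      · simp only [t', if_neg h, Set.indicator, Set.mem_setOf_eq]
        linarith [hU0 c hc]
    rw [integral_add ht'int (hgint.indicator (hKm c))] at h1
    linarith

lemma aux_sSup_eq (P Q : Set ℝ) (hQP : Q ⊆ P) (hP : P.Nonempty)
    (h : ∀ r ∈ P, ∀ ε > 0, ∃ r' ∈ Q, r - ε ≤ r') : sSup P = sSup Q := by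
  have hub : ∀ x, x ∈ upperBounds P ↔ x ∈ upperBounds Q := by
    intro x
    refine ⟨fun hx r hr => hx (hQP hr), fun hx r hr => ?_⟩
    refine le_of_forall_pos_le_add fun ε hε => ?_
    obtain ⟨r', hr', h'⟩ := h r hr ε hε
    linarith [hx hr']
  obtain ⟨r0, hr0⟩ := hP
  obtain ⟨r1, hr1, -⟩ := h r0 hr0 1 one_pos
  by_cases hb : BddAbove P
  · have hl := isLUB_csSup ⟨r0, hr0⟩ hb
    have hbQ : BddAbove Q := hb.mono hQP
    have hl' := isLUB_csSup ⟨r1, hr1⟩ hbQ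
    have e : upperBounds P = upperBounds Q := Set.ext hub
    rw [IsLUB, e] at hl
    exact IsLUB.unique (s := Q) hl hl'
  · have hbQ : ¬ BddAbove Q := fun ⟨x, hx⟩ => hb ⟨x, (hub x).2 hx⟩
    rw [Real.sSup_of_not_bddAbove hb, Real.sSup_of_not_bddAbove hbQ]

theorem stmt17 (m : ℕ) (α0 β : Fin m → ℝ) (lbar : Fin m)
    (hα : α0 lbar = 0) (hβ : β lbar = 0)
    (T : Set ℝ) (hT : Convex ℝ T) (h0T : (0 : ℝ) ∈ T)
    (μ : Measure ℝ) [IsProbabilityMeasure μ] (hμT : μ T = 1)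
    (hL1 : Integrable (fun τ : ℝ => τ) μ)
    (f : ℝ → ℝ≥0∞) (hμdens : μ = (MeasureTheory.volume.restrict T).withDensity f)
    (hfpos : ∀ τ ∈ T, 0 < f τ)
    (b0 : Fin m → ℝ) (hb0 : b0 ∈ stdSimplex ℝ (Fin m)) (hb0β : β ⬝ᵥ b0 = 0)
    (hb0opt : ∀ q ∈ stdSimplex ℝ (Fin m), β ⬝ᵥ q = 0 → α0 ⬝ᵥ q ≤ α0 ⬝ᵥ b0) :
    sSup {r : ℝ | ∃ q : ℝ → Fin m → ℝ, ∃ t : ℝ → ℝ,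
        Measurable t ∧
        (∀ τ ∈ T, q τ ∈ stdSimplex ℝ (Fin m)) ∧
        (∀ τ ∈ T, ∀ τ' ∈ T,
          (α0 + τ • β) ⬝ᵥ q τ' - t τ' ≤ (α0 + τ • β) ⬝ᵥ q τ - t τ) ∧
        (∀ τ ∈ T, 0 ≤ (α0 + τ • β) ⬝ᵥ q τ - t τ) ∧
        r = ∫ τ, t τ ∂μ}
    = sSup {r : ℝ | ∃ q : ℝ → Fin m → ℝ, ∃ t : ℝ → ℝ,
        Measurable t ∧
        (∀ τ ∈ T, q τ ∈ stdSimplex ℝ (Fin m)) ∧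
        (∀ τ ∈ T, q τ = b0 ∨ ∃ l : Fin m, q τ = Pi.single l 1) ∧
        (∀ τ ∈ T, ∀ τ' ∈ T,
          (α0 + τ • β) ⬝ᵥ q τ' - t τ' ≤ (α0 + τ • β) ⬝ᵥ q τ - t τ) ∧
        (∀ τ ∈ T, 0 ≤ (α0 + τ • β) ⬝ᵥ q τ - t τ) ∧
        r = ∫ τ, t τ ∂μ} := by
  have hTo : T.OrdConnected := hT.ordConnected
  have hμ : ∀ᵐ τ ∂μ, τ ∈ T := by
    rw [ae_iff]
    exact (prob_compl_eq_zero_iff hTo.measurableSet).2 hμT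
  refine aux_sSup_eq _ _ ?_ ?_ ?_
  · rintro r ⟨q, t, h1, h2, -, h4, h5, h6⟩
    exact ⟨q, t, h1, h2, h4, h5, h6⟩
  · refine ⟨_, fun _ => b0, fun _ => α0 ⬝ᵥ b0, measurable_const, fun _ _ => hb0,
      fun _ _ _ _ => le_rfl, fun τ _ => ?_, rfl⟩
    rw [add_dotProduct, smul_dotProduct, hb0β]
    simp
  · rintro r ⟨q, t, h1, h2, h3, h4, rfl⟩ ε hε
    obtain ⟨q', t', g1, g2, g3, g4, ⟨c, hc, hc0⟩, g5⟩ :=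
      aux_step α0 β T ⟨0, h0T⟩ μ hμ hL1 b0 hb0 hb0β q t h1 h2 h3 h4 ε hε
    obtain ⟨q'', t'', k1, k2, k3, k4, k5, k6⟩ :=
      aux_core α0 β lbar T hTo μ hμ hL1 b0 hb0 hb0β hb0opt q' t' g1 g2 g3 g4 c hc hc0
    exact ⟨_, ⟨q'', t'', k1, k2, k3, k4, k5, rfl⟩, g5.trans k6⟩
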